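/- arXiv:2108.02979 — 13 statements merged into one kernel-verified Lean document; each statement's English description precedes it below -/
import Mathlib

section
/- Let G be a simple graph and let f be a 3-rs colouring of G. Then every vertex u of G of degree at least 3 satisfies f(u) ∈ {0,1}. -/
/-- A `k`-restricted star colouring (`k`-rs colouring) of a simple graph `G`:
a proper colouring with colours `{0,…,k-1}` such that there is no path `x,y,z`
on three distinct vertices with `f x = f z < f y`. -/
def IsRSColoring {V : Type*} (G : SimpleGraph V) (k : ℕ) (f : V → ℕ) : Prop :=
  (∀ v, f v < k) ∧
  (∀ ⦃x y⦄, G.Adj x y → f x ≠ f y) ∧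
  ∀ ⦃x y z⦄, G.Adj x y → G.Adj y z → x ≠ z → ¬(f x = f z ∧ f z < f y)

theorem rs_three_plus_vertex_binary {V : Type*} [Fintype V]
    (G : SimpleGraph V) [DecidableRel G.Adj] (f : V → ℕ)
    (hf : IsRSColoring G 3 f) (u : V) (hu : 3 ≤ G.degree u) :
    f u = 0 ∨ f u = 1 := by
  obtain ⟨h1, h2, h3⟩ := hf
  by_contra hne
  have hu2 : f u = 2 := by
    have := h1 u
    omega
  have hlt : ∀ v, G.Adj u v → f v < 2 := by
    intro v hv
    have a := h1 v
    have b := h2 hv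
    omega
  obtain ⟨x, hx, y, hy, hxy, he⟩ :=
    Finset.exists_ne_map_eq_of_card_lt_of_maps_to
      (s := G.neighborFinset u) (t := Finset.range 2) (f := f)
      (by rw [Finset.card_range, SimpleGraph.card_neighborFinset_eq_degree]; omega)
      (by
        intro v hv
        have hv2 : G.Adj u v := by simpa using hv
        simpa using hlt v hv2)
  have hx2 : G.Adj u x := by simpa using hx
  have hy2 : G.Adj u y := by simpa using hy
  exact h3 hx2.symm hy2 hxy ⟨he, by rw [hu2]; exact hlt y hy2⟩
end

section
/- Let G be a simple graph and let f be a 3-rs colouring of G. If uv is an edge of G such that both u and v have degree at least 3 in G, then f(v) = 1 − f(u); in particular {f(u), f(v)} = {0,1}. -/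
theorem rs_three_plus_ne_two {V : Type*} [Fintype V]
    (G : SimpleGraph V) [DecidableRel G.Adj] (f : V → ℕ)
    (hf : IsRSColoring G 3 f) (u : V) (hu : 3 ≤ G.degree u) : f u < 2 := by
  obtain ⟨h1, h2, h3⟩ := hf
  by_contra h
  have hu2 : f u = 2 := by have := h1 u; omega
  have hlt : ∀ x, G.Adj u x → f x < 2 := by
    intro x hx
    have a := h1 x
    have b := h2 hx
    omega
  have hc : (Finset.range 2).card < (G.neighborFinset u).card := by
    rw [Finset.card_range, G.card_neighborFinset_eq_degree]
    omega
  obtain ⟨x, hx, y, hy, hxy, he⟩ :=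
    Finset.exists_ne_map_eq_of_card_lt_of_maps_to hc (f := f) (by
      intro x hx
      have hx' : G.Adj u x := by simpa using hx
      simpa using hlt x hx')
  rw [SimpleGraph.mem_neighborFinset] at hx hy
  exact h3 hx.symm hy hxy ⟨he, by have := hlt y hy; omega⟩

theorem rs_edge_between_three_plus {V : Type*} [Fintype V]
    (G : SimpleGraph V) [DecidableRel G.Adj] (f : V → ℕ)
    (hf : IsRSColoring G 3 f) (u v : V) (huv : G.Adj u v)
    (hu : 3 ≤ G.degree u) (hv : 3 ≤ G.degree v) :
    f v = 1 - f u ∧ ({f u, f v} : Set ℕ) = {0, 1} := by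
  have a := rs_three_plus_ne_two G f hf u hu
  have b := rs_three_plus_ne_two G f hf v hv
  have c := hf.2.1 huv
  have d : (f u = 0 ∧ f v = 1) ∨ (f u = 1 ∧ f v = 0) := by omega
  rcases d with ⟨d, e⟩ | ⟨d, e⟩
  · simp [d, e]
  · simp [d, e, Set.pair_comm]
end

section
/- Let G be a simple graph and let f be a 3-rs colouring of G. If u,v,w,x is a path on four distinct vertices in G (uv, vw, wx edges), then it is not the case that one of the endpoints u, x is coloured 0 by f and the other is coloured 1 by f. -/
theorem rs_P4_endpoints_not_zero_one {V : Type*}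
    (G : SimpleGraph V) (f : V → ℕ) (hf : IsRSColoring G 3 f)
    (u v w x : V) (huv : G.Adj u v) (hvw : G.Adj v w) (hwx : G.Adj w x)
    (huw : u ≠ w) (hvx : v ≠ x) (hux : u ≠ x) :
    ¬((f u = 0 ∧ f x = 1) ∨ (f u = 1 ∧ f x = 0)) := by
  obtain ⟨hk, hp, hs⟩ := hf
  have h1 := hk v
  have h2 := hk w
  have h3 := hp huv
  have h4 := hp hvw
  have h5 := hp hwx
  have h6 := hs huv hvw huw
  have h7 := hs hvw hwx hvx
  omega
end

section
/- Let G be a simple graph and let f be a 3-rs colouring of G. If u,v,w,x,y,z is a path on six distinct vertices in G (consecutive vertices adjacent), then it is not the case that f(u) = 0 and f(z) = 0. -/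
theorem rs_P6_endpoints_not_both_zero {V : Type*}
    (G : SimpleGraph V) (f : V → ℕ) (hf : IsRSColoring G 3 f)
    (u v w x y z : V)
    (huv : G.Adj u v) (hvw : G.Adj v w) (hwx : G.Adj w x)
    (hxy : G.Adj x y) (hyz : G.Adj y z)
    (huw : u ≠ w) (hux : u ≠ x) (huy : u ≠ y) (huz : u ≠ z)
    (hvx : v ≠ x) (hvy : v ≠ y) (hvz : v ≠ z)
    (hwy : w ≠ y) (hwz : w ≠ z) (hxz : x ≠ z) :
    ¬(f u = 0 ∧ f z = 0) := by
  obtain ⟨h3, hp, hr⟩ := hf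
  rintro ⟨hu, hz⟩
  have := h3 v
  have := h3 w
  have := h3 x
  have := h3 y
  have := hp huv
  have := hp hvw
  have := hp hwx
  have := hp hxy
  have := hp hyz
  have := hr huv hvw huw
  have := hr hvw hwx hvx
  have := hr hwx hxy hwy
  have := hr hxy hyz hxz
  omega
end

section
/- Let k ∈ ℕ, let G be a simple graph with maximum degree k, and let H be a simple graph containing G as an induced subgraph such that: every vertex of H not in V(G) has degree 1 in H and its unique neighbour lies in V(G), and every vertex of V(G) has degree exactly k+1 in H. Then G is k-rs colourable if and only if H is (k+1)-rs colourable. -/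
/-- If `G` has maximum degree `k` and `H` is obtained from `G` by adding pendant
vertices so that every original vertex has degree `k+1` in `H`, then
`G` is `k`-rs colourable iff `H` is `(k+1)`-rs colourable. -/
theorem rs_colourable_add_pendants {V W : Type*} [Fintype V] [Fintype W]
    (k : ℕ) (G : SimpleGraph V) [DecidableRel G.Adj]
    (H : SimpleGraph W) [DecidableRel H.Adj]
    (φ : G ↪g H)
    (hmax : ∀ v : V, G.degree v ≤ k) (hattained : ∃ v : V, G.degree v = k)
    (hpendant : ∀ w : W, w ∉ Set.range ⇑φ →
      H.degree w = 1 ∧ ∀ u : W, H.Adj w u → u ∈ Set.range ⇑φ)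
    (hdeg : ∀ v : V, H.degree (φ v) = k + 1) :
    (∃ f : V → ℕ, IsRSColoring G k f) ↔ (∃ f : W → ℕ, IsRSColoring H (k + 1) f) := by
  classical
  constructor
  · rintro ⟨f, h1, h2, h3⟩
    let g : W → ℕ := fun w => if h : ∃ v, φ v = w then f h.choose else k
    have g1 : ∀ v, g (φ v) = f v := by
      intro v
      have h : ∃ u, φ u = φ v := ⟨v, rfl⟩
      have e : h.choose = v := φ.injective h.choose_spec
      simp only [g, dif_pos h, e]
    have g2 : ∀ w, (¬ ∃ v, φ v = w) → g w = k := fun w h => by simp only [g, dif_neg h]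
    refine ⟨g, ?_, ?_, ?_⟩
    · intro w
      by_cases h : ∃ v, φ v = w
      · obtain ⟨v, rfl⟩ := h
        rw [g1]; have := h1 v; omega
      · rw [g2 w h]; omega
    · intro x y hxy
      by_cases hx : ∃ v, φ v = x
      · obtain ⟨v, rfl⟩ := hx
        by_cases hy : ∃ v, φ v = y
        · obtain ⟨u, rfl⟩ := hy
          rw [g1, g1]
          exact h2 (φ.map_adj_iff.1 hxy)
        · rw [g1, g2 y hy]; exact (h1 v).ne
      · obtain ⟨u, rfl⟩ := (hpendant x hx).2 y hxy
        rw [g1, g2 x hx]; exact (h1 u).ne'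
    · intro x y z hxy hyz hne ⟨e1, e2⟩
      by_cases hy : ∃ v, φ v = y
      · obtain ⟨v, rfl⟩ := hy
        rw [g1] at e2
        have hv := h1 v
        by_cases hx : ∃ v, φ v = x
        · by_cases hz : ∃ v, φ v = z
          · obtain ⟨a, rfl⟩ := hx
            obtain ⟨b, rfl⟩ := hz
            rw [g1] at e2
            rw [g1, g1] at e1
            exact h3 (φ.map_adj_iff.1 hxy) (φ.map_adj_iff.1 hyz)
              (fun h => hne (by rw [h])) ⟨e1, e2⟩
          · rw [g2 z hz] at e2; omega
        · rw [g2 x hx] at e1; omega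
      · have hd := (hpendant y hy).1
        rw [← SimpleGraph.card_neighborFinset_eq_degree] at hd
        exact hne (Finset.card_le_one.1 hd.le x (by simpa using hxy.symm) z (by simpa using hyz))
  · rintro ⟨f, h1, h2, h3⟩
    refine ⟨fun v => f (φ v), ?_, ?_, ?_⟩
    · intro v
      by_contra hk
      change ¬ (f (φ v) < k) at hk
      have hlt := h1 (φ v)
      have hc := hdeg v
      rw [← SimpleGraph.card_neighborFinset_eq_degree] at hc
      have hb : ∀ x ∈ H.neighborFinset (φ v), f x < k := by
        intro x hx
        have := h1 x
        have := h2 ((H.mem_neighborFinset _ _).1 hx)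
        omega
      have : (H.neighborFinset (φ v)).card ≤ (Finset.range k).card := by
        apply Finset.card_le_card_of_injOn f
        · intro x hx
          simpa using hb x hx
        · intro x hx z hz e
          by_contra hne
          have hz' := hb z hz
          exact h3 ((H.mem_neighborFinset _ _).1 hx).symm ((H.mem_neighborFinset _ _).1 hz) hne
            ⟨e, by omega⟩
      rw [Finset.card_range] at this
      omega
    · intro x y h
      exact h2 (φ.map_adj_iff.2 h)
    · intro x y z hxy hyz hne
      exact h3 (φ.map_adj_iff.2 hxy) (φ.map_adj_iff.2 hyz) (fun h => hne (φ.injective h))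
end

section
/- For every finite simple graph G on n vertices, the rs chromatic number of G satisfies χ_rs(G) ≤ n − α(G) + 1, where α(G) is the independence number of G. -/
/-- The rs chromatic number: the least `k` such that `G` admits a `k`-rs colouring. -/
noncomputable def rsChromaticNumber {V : Type*} (G : SimpleGraph V) : ℕ :=
  sInf {k | ∃ f : V → ℕ, IsRSColoring G k f}

/-- The independence number: the largest size of an independent set of vertices. -/
noncomputable def indepNumber {V : Type*} (G : SimpleGraph V) : ℕ :=
  sSup {n | ∃ s : Finset V, (∀ u ∈ s, ∀ v ∈ s, ¬ G.Adj u v) ∧ s.card = n}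

theorem rsChromaticNumber_le_card_sub_indepNumber_add_one
    {V : Type*} [Fintype V] (G : SimpleGraph V) :
    rsChromaticNumber G ≤ Fintype.card V - indepNumber G + 1 := by
  classical
  have hmem : indepNumber G ∈
      {n | ∃ s : Finset V, (∀ u ∈ s, ∀ v ∈ s, ¬ G.Adj u v) ∧ s.card = n} := by
    apply Nat.sSup_mem
    · exact ⟨0, ∅, by simp, by simp⟩
    · refine ⟨Fintype.card V, ?_⟩
      rintro n ⟨s, _, rfl⟩
      exact Finset.card_le_univ s
  obtain ⟨s, hs, hcard⟩ := hmem
  rw [← hcard, ← Finset.card_compl]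
  let e := sᶜ.equivFin
  apply Nat.sInf_le
  let f : V → ℕ := fun v => if h : v ∈ sᶜ then (e ⟨v, h⟩ : ℕ) else sᶜ.card
  have f1 : ∀ v, f v ≤ sᶜ.card := by
    intro v
    by_cases h : v ∈ sᶜ
    · simp only [f, dif_pos h]; exact (e ⟨v, h⟩).2.le
    · simp only [f, dif_neg h]; exact le_rfl
  have f2 : ∀ v, v ∈ sᶜ → f v < sᶜ.card := by
    intro v h
    simp only [f, dif_pos h]; exact (e ⟨v, h⟩).2
  have f3 : ∀ v, v ∉ sᶜ → f v = sᶜ.card := by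
    intro v h
    simp only [f, dif_neg h]
  have key : ∀ x z, x ≠ z → f x = f z → x ∈ s ∧ z ∈ s := by
    intro x z hne heq
    by_cases hx : x ∈ sᶜ
    · by_cases hz : z ∈ sᶜ
      · exfalso
        simp only [f, dif_pos hx, dif_pos hz] at heq
        have := e.injective (Fin.ext heq)
        exact hne (congrArg Subtype.val this)
      · have := f2 x hx; have := f3 z hz; omega
    · by_cases hz : z ∈ sᶜ
      · have := f2 z hz; have := f3 x hx; omega
      · simpa using And.intro hx hz
  refine ⟨f, fun v => Nat.lt_succ_of_le (f1 v), ?_, ?_⟩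
  · intro x y hxy heq
    obtain ⟨hx, hy⟩ := key x y hxy.ne heq
    exact hs x hx y hy hxy
  · rintro x y z _ _ hne ⟨heq, hlt⟩
    obtain ⟨_, hz⟩ := key x z hne heq
    have h3 := f3 z (by simpa using hz)
    have h1 := f1 y
    omega
end

section
/- Let T be a tree (a connected acyclic simple graph) and let e = u₁u₂ be an edge of T. Let U₁ and U₂ be the vertex sets of the two components of T − e, with u₁ ∈ U₁ and u₂ ∈ U₂. Suppose G₁ = T[U₁ ∪ {u₂}] admits a 3-rs colouring f₁ and G₂ = T[U₂ ∪ {u₁}] admits a 3-rs colouring f₂, and suppose f₁(u₁) = f₂(u₁) and f₁(u₂) = f₂(u₂). Then the function f on V(T) defined by f(w) = fᵢ(w) for w ∈ Uᵢ (i = 1,2) is a 3-rs colouring of T. -/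
/-- `f` restricted to `S` is a `k`-rs colouring of the subgraph of `G` induced by `S`. -/
def IsRSColoringOn {V : Type*} (G : SimpleGraph V) (S : Set V) (k : ℕ) (f : V → ℕ) : Prop :=
  (∀ v ∈ S, f v < k) ∧
  (∀ x ∈ S, ∀ y ∈ S, G.Adj x y → f x ≠ f y) ∧
  ∀ x ∈ S, ∀ y ∈ S, ∀ z ∈ S, G.Adj x y → G.Adj y z → x ≠ z → ¬(f x = f z ∧ f z < f y)

/-- Combining 3-rs colourings of the two sides of an edge of a tree. -/
theorem rs_combine_at_edge {V : Type*} (T : SimpleGraph V) (hT : T.IsTree)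
    (u₁ u₂ : V) (he : T.Adj u₁ u₂)
    (U₁ U₂ : Set V)
    (hU₁ : U₁ = {v | (T.deleteEdges {s(u₁, u₂)}).Reachable u₁ v})
    (hU₂ : U₂ = {v | (T.deleteEdges {s(u₁, u₂)}).Reachable u₂ v})
    (f₁ f₂ f : V → ℕ)
    (h₁ : IsRSColoringOn T (U₁ ∪ {u₂}) 3 f₁)
    (h₂ : IsRSColoringOn T (U₂ ∪ {u₁}) 3 f₂)
    (hagree₁ : f₁ u₁ = f₂ u₁) (hagree₂ : f₁ u₂ = f₂ u₂)
    (hf₁ : ∀ w ∈ U₁, f w = f₁ w) (hf₂ : ∀ w ∈ U₂, f w = f₂ w) :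
    IsRSColoring T 3 f := by
  have m₁ : u₁ ∈ U₁ := by rw [hU₁]; exact SimpleGraph.Reachable.refl _
  have m₂ : u₂ ∈ U₂ := by rw [hU₂]; exact SimpleGraph.Reachable.refl _
  have c₁ : ∀ x y, x ∈ U₁ → T.Adj x y → y ∈ U₁ ∪ {u₂} := by
    intro x y hx hxy
    by_cases hs : s(x, y) = s(u₁, u₂)
    · rcases Sym2.eq_iff.1 hs with ⟨_, h⟩ | ⟨_, h⟩
      · exact Or.inr h
      · exact Or.inl (h ▸ m₁)
    · left
      rw [hU₁] at hx ⊢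
      refine SimpleGraph.Reachable.trans hx (SimpleGraph.Adj.reachable ?_)
      rw [SimpleGraph.deleteEdges_adj]
      exact ⟨hxy, hs⟩
  have c₂ : ∀ x y, x ∈ U₂ → T.Adj x y → y ∈ U₂ ∪ {u₁} := by
    intro x y hx hxy
    by_cases hs : s(x, y) = s(u₁, u₂)
    · rcases Sym2.eq_iff.1 hs with ⟨_, h⟩ | ⟨_, h⟩
      · exact Or.inl (h ▸ m₂)
      · exact Or.inr h
    · left
      rw [hU₂] at hx ⊢
      refine SimpleGraph.Reachable.trans hx (SimpleGraph.Adj.reachable ?_)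
      rw [SimpleGraph.deleteEdges_adj]
      exact ⟨hxy, hs⟩
  have g₁ : ∀ w ∈ U₁ ∪ {u₂}, f w = f₁ w := by
    rintro w (hw | hw)
    · exact hf₁ w hw
    · obtain rfl : w = u₂ := hw
      rw [hf₂ w m₂, hagree₂]
  have g₂ : ∀ w ∈ U₂ ∪ {u₁}, f w = f₂ w := by
    rintro w (hw | hw)
    · exact hf₂ w hw
    · obtain rfl : w = u₁ := hw
      rw [hf₁ w m₁, hagree₁]
  have walk : ∀ a b : V, T.Walk a b → (a ∈ U₁ ∨ a ∈ U₂) → (b ∈ U₁ ∨ b ∈ U₂) := by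
    intro a b p
    induction p with
    | nil => exact id
    | cons h _ ih =>
      intro ha
      apply ih
      rcases ha with ha | ha
      · rcases c₁ _ _ ha h with h | h
        · exact Or.inl h
        · exact Or.inr (Set.mem_singleton_iff.1 h ▸ m₂)
      · rcases c₂ _ _ ha h with h | h
        · exact Or.inr h
        · exact Or.inl (Set.mem_singleton_iff.1 h ▸ m₁)
  have cover : ∀ v, v ∈ U₁ ∨ v ∈ U₂ := fun v => by
    obtain ⟨p⟩ := hT.1.preconnected u₁ v
    exact walk _ _ p (Or.inl m₁)
  obtain ⟨a₁, b₁, d₁⟩ := h₁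
  obtain ⟨a₂, b₂, d₂⟩ := h₂
  refine ⟨fun v => ?_, fun x y hxy => ?_, fun x y z hxy hyz hxz => ?_⟩
  · rcases cover v with h | h
    · rw [hf₁ v h]; exact a₁ v (Or.inl h)
    · rw [hf₂ v h]; exact a₂ v (Or.inl h)
  · rcases cover x with h | h
    · have hy := c₁ x y h hxy
      rw [hf₁ x h, g₁ y hy]; exact b₁ x (Or.inl h) y hy hxy
    · have hy := c₂ x y h hxy
      rw [hf₂ x h, g₂ y hy]; exact b₂ x (Or.inl h) y hy hxy
  · rcases cover y with h | h
    · have hx := c₁ y x h hxy.symm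
      have hz := c₁ y z h hyz
      rw [hf₁ y h, g₁ x hx, g₁ z hz]
      exact d₁ x hx y (Or.inl h) z hz hxy hyz hxz
    · have hx := c₂ y x h hxy.symm
      have hz := c₂ y z h hyz
      rw [hf₂ y h, g₂ x hx, g₂ z hz]
      exact d₂ x hx y (Or.inl h) z hz hxy hyz hxz
end

section
/- Let T be a tree (a connected acyclic simple graph) and let v be a vertex of T. Let U₁ be the vertex set of one component of T − v and let U₂ = V(T − v) \ U₁. Suppose that for i = 1,2 the induced subgraph Gᵢ = T[Uᵢ ∪ {v}] admits a 3-rs colouring fᵢ with fᵢ(v) = 0. Then the function f on V(T) defined by f(w) = fᵢ(w) for w ∈ V(Gᵢ) (i = 1,2) is a 3-rs colouring of T. -/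
/-- Combining 3-rs colourings of two parts of a tree meeting at a vertex coloured 0. -/
theorem rs_combine_at_vertex {V : Type*} (T : SimpleGraph V) (hT : T.IsTree)
    (v : V) (U₁ U₂ : Set V) (hvU₁ : v ∉ U₁)
    (hconn : (T.induce U₁).Connected)
    (hclosed : ∀ x ∈ U₁, ∀ y : V, T.Adj x y → y ∈ U₁ ∪ {v})
    (hU₂ : U₂ = {v}ᶜ \ U₁)
    (f₁ f₂ f : V → ℕ)
    (h₁ : IsRSColoringOn T (U₁ ∪ {v}) 3 f₁)
    (h₂ : IsRSColoringOn T (U₂ ∪ {v}) 3 f₂)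
    (hf₁v : f₁ v = 0) (hf₂v : f₂ v = 0)
    (hf₁ : ∀ w ∈ U₁ ∪ {v}, f w = f₁ w) (hf₂ : ∀ w ∈ U₂ ∪ {v}, f w = f₂ w) :
    IsRSColoring T 3 f := by
  obtain ⟨a1, b1, c1⟩ := h₁
  obtain ⟨a2, b2, c2⟩ := h₂
  have hv : f v = 0 := by rw [hf₁ v (by simp), hf₁v]
  have cov : ∀ w, w ≠ v → w ∈ U₁ ∨ w ∈ U₂ := by
    intro w hw
    by_cases h : w ∈ U₁
    · exact Or.inl h
    · right; rw [hU₂]; exact ⟨hw, h⟩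
  have A1 : ∀ w ∈ U₁, w ∈ U₁ ∪ {v} := fun w h => Or.inl h
  have A2 : ∀ w ∈ U₂, w ∈ U₂ ∪ {v} := fun w h => Or.inl h
  have V1 : v ∈ U₁ ∪ {v} := by simp
  have V2 : v ∈ U₂ ∪ {v} := by simp
  have hclosed2 : ∀ x ∈ U₂, ∀ y, T.Adj x y → y ∈ U₂ ∪ {v} := by
    intro x hx y hxy
    by_cases hy : y = v
    · rw [hy]; exact V2
    · rcases cov y hy with h | h
      · rw [hU₂] at hx
        rcases hclosed y h x hxy.symm with h' | h'
        · exact absurd h' hx.2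
        · exact absurd h' hx.1
      · exact A2 y h
  refine ⟨?_, ?_, ?_⟩
  · intro w
    by_cases hw : w = v
    · rw [hw, hv]; norm_num
    · rcases cov w hw with h | h
      · rw [hf₁ w (A1 w h)]; exact a1 w (A1 w h)
      · rw [hf₂ w (A2 w h)]; exact a2 w (A2 w h)
  · have key : ∀ x y, x ≠ v → T.Adj x y → f x ≠ f y := by
      intro x y hx hxy
      rcases cov x hx with h | h
      · have hy := hclosed x h y hxy
        rw [hf₁ x (A1 x h), hf₁ y hy]
        exact b1 x (A1 x h) y hy hxy
      · have hy := hclosed2 x h y hxy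
        rw [hf₂ x (A2 x h), hf₂ y hy]
        exact b2 x (A2 x h) y hy hxy
    intro x y hxy
    by_cases hx : x = v
    · have hy : y ≠ v := fun h => hxy.ne (hx.trans h.symm)
      exact (key y x hy hxy.symm).symm
    · exact key x y hx hxy
  · intro x y z hxy hyz hxz
    by_cases hy : y = v
    · rintro ⟨_, h⟩
      rw [hy, hv] at h
      exact absurd h (Nat.not_lt_zero _)
    · rcases cov y hy with h | h
      · have hx := hclosed y h x hxy.symm
        have hz := hclosed y h z hyz
        rw [hf₁ x hx, hf₁ y (A1 y h), hf₁ z hz]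
        exact c1 x hx y (A1 y h) z hz hxy hyz hxz
      · have hx := hclosed2 y h x hxy.symm
        have hz := hclosed2 y h z hyz
        rw [hf₂ x hx, hf₂ y (A2 y h), hf₂ z hz]
        exact c2 x hx y (A2 y h) z hz hxy hyz hxz
end

section
/- For every n ≥ 7 and every i, j ∈ {0,1}, the path graph P_n on vertices v₁, v₂, …, v_n (with edges v_t v_{t+1} for 1 ≤ t < n) admits a 3-rs colouring f with f(v₁) = i and f(v_n) = j. -/
def RSW (n : ℕ) (i j : ℕ) (g : ℕ → ℕ) : Prop :=
  (∀ k < n, g k < 3) ∧ (∀ k < n - 1, g k ≠ g (k + 1)) ∧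
  (∀ k < n - 2, ¬ (g k = g (k + 2) ∧ g k < g (k + 1))) ∧
  g 0 ≠ g 2 ∧ g 0 = i ∧ g (n - 1) = j

instance (n i j : ℕ) (g : ℕ → ℕ) : Decidable (RSW n i j g) := by
  unfold RSW; infer_instance

theorem RSW_step {n i j : ℕ} (hn : 7 ≤ n) {g : ℕ → ℕ} (h : RSW n i j g) :
    RSW (n + 3) i j (fun k => if k < 3 then g k else g (k - 3)) := by
  obtain ⟨h1, h2, h3, h4, h5, h6⟩ := h
  have a0 := h2 0 (by omega)
  have a1 := h2 1 (by omega)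
  simp only [Nat.zero_add, Nat.reduceAdd] at a0 a1
  refine ⟨?_, ?_, ?_, ?_, ?_, ?_⟩
  · intro k hk
    dsimp only
    split_ifs
    · exact h1 _ (by omega)
    · exact h1 _ (by omega)
  · intro k hk
    rcases k with _ | _ | _ | k
    · simpa using a0
    · simpa using a1
    · simpa using h4.symm
    · have := h2 k (by omega)
      simpa [show ¬ (k + 1 + 1 + 1 < 3) by omega, show ¬ (k + 1 + 1 + 1 + 1 < 3) by omega,
        show ¬ (k + 1 + 1 + 1 + 2 < 3) by omega, show k + 1 + 1 + 1 + 1 - 3 = k + 1 by omega] using this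
  · intro k hk
    rcases k with _ | _ | _ | k
    · simp; omega
    · simp; omega
    · simp; omega
    · have := h3 k (by omega)
      simpa [show ¬ (k + 1 + 1 + 1 < 3) by omega, show ¬ (k + 1 + 1 + 1 + 1 < 3) by omega,
        show ¬ (k + 1 + 1 + 1 + 2 < 3) by omega, show k + 1 + 1 + 1 + 1 - 3 = k + 1 by omega,
        show k + 1 + 1 + 1 + 2 - 3 = k + 2 by omega] using this
  · simpa using h4
  · simpa using h5
  · rw [← h6]
    simp only [show ¬ (n + 3 - 1 < 3) by omega, if_false]
    congr 1

theorem RSW_exists (n : ℕ) (hn : 7 ≤ n) (i j : ℕ)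
    (hi : i = 0 ∨ i = 1) (hj : j = 0 ∨ j = 1) : ∃ g, RSW n i j g := by
  induction n using Nat.strong_induction_on with
  | _ n ih =>
  by_cases h : 10 ≤ n
  · obtain ⟨g, hg⟩ := ih (n - 3) (by omega) (by omega)
    have := RSW_step (by omega) hg
    rw [show n - 3 + 3 = n by omega] at this
    exact ⟨_, this⟩
  · have : n = 7 ∨ n = 8 ∨ n = 9 := by omega
    rcases this with rfl | rfl | rfl <;> rcases hi with rfl | rfl <;> rcases hj with rfl | rfl
    · exact ⟨fun k => ([0, 1, 2, 0, 1, 2, 0] : List ℕ).getD k 0, by decide⟩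
    · exact ⟨fun k => ([0, 2, 1, 2, 0, 2, 1] : List ℕ).getD k 0, by decide⟩
    · exact ⟨fun k => ([1, 2, 0, 2, 1, 2, 0] : List ℕ).getD k 0, by decide⟩
    · exact ⟨fun k => ([1, 0, 2, 1, 0, 2, 1] : List ℕ).getD k 0, by decide⟩
    · exact ⟨fun k => ([0, 1, 2, 0, 2, 1, 2, 0] : List ℕ).getD k 0, by decide⟩
    · exact ⟨fun k => ([0, 1, 2, 0, 1, 2, 0, 1] : List ℕ).getD k 0, by decide⟩
    · exact ⟨fun k => ([1, 0, 2, 1, 0, 1, 2, 0] : List ℕ).getD k 0, by decide⟩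
    · exact ⟨fun k => ([1, 0, 2, 1, 2, 0, 2, 1] : List ℕ).getD k 0, by decide⟩
    · exact ⟨fun k => ([0, 2, 1, 2, 0, 2, 1, 2, 0] : List ℕ).getD k 0, by decide⟩
    · exact ⟨fun k => ([0, 1, 2, 0, 1, 2, 0, 2, 1] : List ℕ).getD k 0, by decide⟩
    · exact ⟨fun k => ([1, 0, 2, 1, 0, 2, 1, 2, 0] : List ℕ).getD k 0, by decide⟩
    · exact ⟨fun k => ([1, 0, 2, 1, 0, 1, 2, 0, 1] : List ℕ).getD k 0, by decide⟩



/-- For `n ≥ 7` and binary colours `i, j`, the path `P_n` has a 3-rs colouring with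
endpoints coloured `i` and `j`. -/
theorem rs_path_colouring_long (n : ℕ) (hn : 7 ≤ n) (i j : ℕ)
    (hi : i = 0 ∨ i = 1) (hj : j = 0 ∨ j = 1) :
    ∃ f : Fin n → ℕ, IsRSColoring (SimpleGraph.pathGraph n) 3 f ∧
      f ⟨0, by omega⟩ = i ∧ f ⟨n - 1, by omega⟩ = j := by
  obtain ⟨g, h1, h2, h3, -, h5, h6⟩ := RSW_exists n hn i j hi hj
  refine ⟨fun v => g v.1, ⟨fun v => h1 _ v.2, ?_, ?_⟩, h5, h6⟩
  · rintro ⟨x, hx⟩ ⟨y, hy⟩ h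
    rw [SimpleGraph.pathGraph_adj] at h
    dsimp only at h ⊢
    rcases h with rfl | rfl
    · exact h2 x (by omega)
    · exact (h2 y (by omega)).symm
  · rintro ⟨x, hx⟩ ⟨y, hy⟩ ⟨z, hz⟩ h h' hne
    rw [SimpleGraph.pathGraph_adj] at h h'
    have hne' : x ≠ z := fun e => hne (by subst e; rfl)
    dsimp only at h h' ⊢
    rcases h with rfl | rfl <;> rcases h' with h' | h'
    · subst h'
      have := h3 x (by omega)
      rintro ⟨e, l⟩
      exact this ⟨e, e ▸ l⟩
    · omega
    · omega
    · subst h'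
      have := h3 z (by omega)
      rintro ⟨e, l⟩
      exact this ⟨e.symm, l⟩
end

section
/- Let G be a simple graph and let (u,v,w) be a triangle in G (three pairwise adjacent vertices). If u, v and w each have degree at least 3 in G, then G admits no 3-rs colouring. -/
theorem rs_ne_two_aux {V : Type*} [Fintype V]
    (G : SimpleGraph V) [DecidableRel G.Adj] (f : V → ℕ) (hf : IsRSColoring G 3 f)
    (a : V) (ha : 3 ≤ G.degree a) : f a ≠ 2 := by
  intro h2
  obtain ⟨h1, hp, hs⟩ := hf
  have hc : (G.neighborFinset a).card ≤ (Finset.range 2).card := by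
    apply Finset.card_le_card_of_injOn f
    · intro x hx
      have hx' : G.Adj a x := by simpa using hx
      have := h1 x
      have := hp hx'
      simp only [Finset.coe_range, Set.mem_Iio]
      omega
    · intro x hx y hy hxy
      have hx' : G.Adj a x := by simpa using hx
      have hy' : G.Adj a y := by simpa using hy
      by_contra hne
      have := h1 y
      have := hp hy'
      exact hs hx'.symm hy' hne ⟨hxy, by omega⟩
  rw [G.card_neighborFinset_eq_degree, Finset.card_range] at hc
  omega

/-- A graph with a triangle whose three vertices all have degree at least 3
admits no 3-rs colouring. -/
theorem no_rs_colouring_of_heavy_triangle {V : Type*} [Fintype V]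
    (G : SimpleGraph V) [DecidableRel G.Adj] (u v w : V)
    (huv : G.Adj u v) (hvw : G.Adj v w) (huw : G.Adj u w)
    (hdu : 3 ≤ G.degree u) (hdv : 3 ≤ G.degree v) (hdw : 3 ≤ G.degree w) :
    ¬ ∃ f : V → ℕ, IsRSColoring G 3 f := by
  rintro ⟨f, hf⟩
  have h1 := rs_ne_two_aux G f hf u hdu
  have h2 := rs_ne_two_aux G f hf v hdv
  have h3 := rs_ne_two_aux G f hf w hdw
  obtain ⟨hb, hp, -⟩ := hf
  have := hb u
  have := hb v
  have := hb w
  have := hp huv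
  have := hp hvw
  have := hp huw
  omega
end

section
/- Let G be a simple graph, let (u,v,w) be a triangle in G (three pairwise adjacent vertices), and suppose w has degree exactly 2 in G. Let G′ be the graph obtained from G − w by adding four new vertices ℓ₁, ℓ₂, ℓ₃, ℓ₄ and the edges uℓ₁, uℓ₂, vℓ₃, vℓ₄ (i.e., attaching two pendant vertices each at u and at v). Then G is 3-rs colourable if and only if G′ is 3-rs colourable. -/
/-- The graph `G'` obtained from `G − w` by adding four new pendant vertices
`ℓ₁, ℓ₂, ℓ₃, ℓ₄` (here `Fin 4`) together with the edges `uℓ₁, uℓ₂, vℓ₃, vℓ₄`. -/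
def removeApexAddPendants {V : Type*} (G : SimpleGraph V) (u v w : V) :
    SimpleGraph ({x : V // x ≠ w} ⊕ Fin 4) :=
  SimpleGraph.fromRel (fun a b =>
    match a, b with
    | Sum.inl a, Sum.inl b => G.Adj a.1 b.1
    | Sum.inl a, Sum.inr i => (a.1 = u ∧ i.1 < 2) ∨ (a.1 = v ∧ 2 ≤ i.1)
    | _, _ => False)

theorem rs_swap_aux {V : Type*} (G : SimpleGraph V) (u v w : V)
    (huv : G.Adj u v) (hvw : G.Adj v w) (huw : G.Adj u w)
    (hw : ∀ x, G.Adj w x → x = u ∨ x = v)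
    (f : V → ℕ) (hf : IsRSColoring G 3 f) (hu : f u = 2) :
    ∃ g : V → ℕ, IsRSColoring G 3 g ∧ g w = 2 := by
  classical
  obtain ⟨h1, h2, h3⟩ := hf
  have hN : ∀ x, G.Adj u x → x = v ∨ x = w := by
    intro x hx
    by_contra! hc
    have a1 := h2 huv
    have a2 := h2 huw
    have a3 := h2 hvw
    have a4 := h2 hx
    have b1 := h3 hx.symm huv hc.1
    have b2 := h3 hx.symm huw hc.2
    have c1 := h1 v
    have c2 := h1 w
    have c3 := h1 x
    omega
  have hadj : ∀ x y, G.Adj x y → G.Adj (Equiv.swap u w x) (Equiv.swap u w y) := by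
    intro x y hxy
    have e1 := huv.symm
    have e2 := hvw.symm
    have e3 := huw.symm
    have e4 := hxy.symm
    have e5 := hxy.ne
    have n1 := hN x
    have n2 := hN y
    have n3 := hw x
    have n4 := hw y
    simp only [Equiv.swap_apply_def]
    grind
  refine ⟨fun x => f (Equiv.swap u w x), ⟨fun x => h1 _, fun x y h => h2 (hadj _ _ h),
    fun x y z h h' hne => h3 (hadj _ _ h) (hadj _ _ h') (fun h => hne ((Equiv.swap u w).injective h))⟩, ?_⟩
  simpa using hu

/-- If `(u,v,w)` is a triangle of `G` and `deg w = 2`, then `G` is 3-rs colourable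
iff the graph obtained from `G − w` by attaching two pendant vertices each at `u`
and at `v` is 3-rs colourable. -/
theorem rs_colourable_remove_triangle_apex {V : Type*} [Fintype V]
    (G : SimpleGraph V) [DecidableRel G.Adj] (u v w : V)
    (huv : G.Adj u v) (hvw : G.Adj v w) (huw : G.Adj u w)
    (hdw : G.degree w = 2) :
    (∃ f : V → ℕ, IsRSColoring G 3 f) ↔
      (∃ f : ({x : V // x ≠ w} ⊕ Fin 4) → ℕ,
        IsRSColoring (removeApexAddPendants G u v w) 3 f) := by
  classical
  have hw : ∀ x, G.Adj w x → x = u ∨ x = v := by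
    intro x hx
    have hsub : ({u, v} : Finset V) ⊆ G.neighborFinset w := by
      intro y hy
      simp only [Finset.mem_insert, Finset.mem_singleton] at hy
      rw [SimpleGraph.mem_neighborFinset]
      rcases hy with rfl | rfl
      · exact huw.symm
      · exact hvw.symm
    have heq := Finset.eq_of_subset_of_card_le hsub (by
      rw [SimpleGraph.card_neighborFinset_eq_degree, hdw, Finset.card_pair huv.ne])
    have : x ∈ G.neighborFinset w := by simpa using hx
    rw [← heq] at this
    simpa using this
  constructor
  · rintro ⟨f, hf⟩
    have key : ∃ g : V → ℕ, IsRSColoring G 3 g ∧ g w = 2 := by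
      by_cases a : f u = 2
      · exact rs_swap_aux G u v w huv hvw huw hw f hf a
      by_cases b : f v = 2
      · exact rs_swap_aux G v u w huv.symm huw hvw (fun x h => (hw x h).symm) f hf b
      refine ⟨f, hf, ?_⟩
      have a1 := hf.2.1 huv
      have a2 := hf.2.1 huw
      have a3 := hf.2.1 hvw
      have c1 := hf.1 u
      have c2 := hf.1 v
      have c3 := hf.1 w
      omega
    obtain ⟨g, ⟨g1, g2, g3⟩, gw⟩ := key
    have gu := g2 huw
    have gv := g2 hvw
    refine ⟨Sum.elim (fun x => g x.1) (fun _ => 2), ?_, ?_, ?_⟩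
    · rintro (x | i)
      · exact g1 _
      · simp
    · rintro (⟨x, hx⟩ | i) (⟨y, hy⟩ | j) h
      · simp [removeApexAddPendants] at h
        exact g2 (by grind [G.adj_comm])
      · simp [removeApexAddPendants] at h
        simp
        grind
      · simp [removeApexAddPendants] at h
        simp
        grind
      · simp [removeApexAddPendants] at h
    · rintro (⟨x, hx⟩ | i) y (⟨z, hz⟩ | j) h h' hne
      · rcases y with ⟨y, hy⟩ | k
        · simp [removeApexAddPendants] at h h'
          refine g3 (x := x) (y := y) (z := z) ?_ ?_ ?_
          · grind [G.adj_comm]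
          · grind [G.adj_comm]
          · grind
        · simp [removeApexAddPendants] at h h'
          grind
      all_goals
        rcases y with ⟨y, hy⟩ | k
        · have := g1 y
          simp
          omega
        · simp [removeApexAddPendants] at h h'
  · rintro ⟨f, f1, f2, f3⟩
    have hu : u ≠ w := huw.ne
    have hv : v ≠ w := hvw.ne
    have A : ∀ x y (hx : x ≠ w) (hy : y ≠ w), G.Adj x y →
        (removeApexAddPendants G u v w).Adj (Sum.inl ⟨x, hx⟩) (Sum.inl ⟨y, hy⟩) := by
      intro x y hx hy h
      simp [removeApexAddPendants, h, h.ne]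
    have U : ∀ i : Fin 4, i.1 < 2 →
        (removeApexAddPendants G u v w).Adj (Sum.inl ⟨u, hu⟩) (Sum.inr i) := by
      intro i h
      simp [removeApexAddPendants]
      omega
    have W : ∀ i : Fin 4, 2 ≤ i.1 →
        (removeApexAddPendants G u v w).Adj (Sum.inl ⟨v, hv⟩) (Sum.inr i) := by
      intro i h
      simp [removeApexAddPendants, h]
    have B : ∀ a b c d, (removeApexAddPendants G u v w).Adj a b →
        (removeApexAddPendants G u v w).Adj a c → (removeApexAddPendants G u v w).Adj a d →
        b ≠ c → c ≠ d → b ≠ d → f a ≠ 2 := by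
      intro a b c d hb hc hd n1 n2 n3
      have := f3 hb.symm hc n1
      have := f3 hc.symm hd n2
      have := f3 hb.symm hd n3
      have := f2 hb
      have := f2 hc
      have := f2 hd
      have := f1 a
      have := f1 b
      have := f1 c
      have := f1 d
      omega
    have fu : f (Sum.inl ⟨u, hu⟩) ≠ 2 :=
      B _ _ _ _ (A u v hu hv huv) (U 0 (by simp)) (U 1 (by simp)) (by simp) (by simp) (by simp)
    have fv : f (Sum.inl ⟨v, hv⟩) ≠ 2 :=
      B _ _ _ _ (A v u hv hu huv.symm) (W 2 (by simp)) (W 3 (by simp)) (by simp) (by simp) (by simp)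
    have fuv := f2 (A u v hu hv huv)
    have f1u := f1 (Sum.inl ⟨u, hu⟩)
    have f1v := f1 (Sum.inl ⟨v, hv⟩)
    obtain ⟨g, hgw, hg⟩ : ∃ g : V → ℕ, g w = 2 ∧ ∀ x (hx : x ≠ w), g x = f (Sum.inl ⟨x, hx⟩) :=
      ⟨fun x => if hx : x = w then 2 else f (Sum.inl ⟨x, hx⟩), by simp, by
        intro x hx; simp [hx]⟩
    have g1 : ∀ x, g x < 3 := by
      intro x
      by_cases hx : x = w
      · subst hx; omega
      · rw [hg x hx]; exact f1 _
    rw [← hg u hu] at fu fuv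
    rw [← hg v hv] at fv fuv
    have gw2 : ∀ x, G.Adj w x → g x ≠ 2 := by
      intro x h
      rcases hw x h with rfl | rfl <;> assumption
    refine ⟨g, g1, ?_, ?_⟩
    · intro x y h
      by_cases hx : x = w
      · subst hx; rw [hgw]; exact (gw2 y h).symm
      by_cases hy : y = w
      · subst hy; rw [hgw]; exact gw2 x h.symm
      rw [hg x hx, hg y hy]
      exact f2 (A x y hx hy h)
    · intro x y z h h' hne
      by_cases hy : y = w
      · subst hy
        rcases hw x h.symm with rfl | rfl <;> rcases hw z h' with rfl | rfl <;>
          first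
          | exact absurd rfl hne
          | omega
      by_cases hx : x = w
      · subst hx; have := g1 y; omega
      by_cases hz : z = w
      · subst hz; have := g1 y; omega
      rw [hg x hx, hg y hy, hg z hz]
      exact f3 (A x y hx hy h) (A y z hy hz h') (by simpa using hne)
end

section
/- If G is a co-bipartite graph (i.e., a finite simple graph whose vertex set can be partitioned into two cliques), then χ_s(G) = χ_rs(G) = χ_o(G), where χ_s, χ_rs and χ_o denote the star chromatic number, the rs chromatic number and the ordered chromatic number respectively. -/
/-- A `k`-star colouring: a proper colouring with colours `{0,…,k-1}` such that no
path on four distinct vertices is bicoloured. -/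
def IsStarColoring {V : Type*} (G : SimpleGraph V) (k : ℕ) (f : V → ℕ) : Prop :=
  (∀ v, f v < k) ∧
  (∀ ⦃x y⦄, G.Adj x y → f x ≠ f y) ∧
  ∀ ⦃a b c d : V⦄, G.Adj a b → G.Adj b c → G.Adj c d →
    a ≠ c → a ≠ d → b ≠ d → ¬(f a = f c ∧ f b = f d)

/-- A `k`-ordered colouring: a proper colouring with colours `{0,…,k-1}` such that
every non-trivial path whose endpoints receive the same colour contains a vertex of
strictly higher colour. -/
def IsOrderedColoring {V : Type*} (G : SimpleGraph V) (k : ℕ) (f : V → ℕ) : Prop :=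
  (∀ v, f v < k) ∧
  (∀ ⦃x y⦄, G.Adj x y → f x ≠ f y) ∧
  ∀ ⦃a b : V⦄ (p : G.Walk a b), p.IsPath → a ≠ b → f a = f b →
    ∃ x ∈ p.support, f a < f x

/-- The star chromatic number. -/
noncomputable def starChromaticNumber {V : Type*} (G : SimpleGraph V) : ℕ :=
  sInf {k | ∃ f : V → ℕ, IsStarColoring G k f}

/-- The ordered chromatic number. -/
noncomputable def orderedChromaticNumber {V : Type*} (G : SimpleGraph V) : ℕ :=
  sInf {k | ∃ f : V → ℕ, IsOrderedColoring G k f}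

theorem aux_relabel (P : ℕ → Prop) (k : ℕ) : ∃ σ : ℕ → ℕ, (∀ c < k, σ c < k) ∧
    (∀ c < k, ∀ d < k, σ c = σ d → c = d) ∧
    (∀ c < k, ∀ d < k, P c → ¬ P d → σ c < σ d) := by
  classical
  let key : ℕ → ℕ := fun c => if P c then c else c + k
  have hinj : ∀ c < k, ∀ d < k, key c = key d → c = d := by
    intro c hc d hd h
    simp only [key] at h
    split_ifs at h <;> omega
  have hlt : ∀ c < k, ∀ d < k, key c < key d →
      ((Finset.range k).filter (fun e => key e < key c)).card <
      ((Finset.range k).filter (fun e => key e < key d)).card := by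
    intro c hc d hd h
    apply Finset.card_lt_card
    rw [Finset.ssubset_iff_of_subset]
    · exact ⟨c, by simp [hc, h], by simp⟩
    · intro e he
      simp only [Finset.mem_filter] at he ⊢
      exact ⟨he.1, he.2.trans h⟩
  refine ⟨fun c => ((Finset.range k).filter (fun e => key e < key c)).card, ?_, ?_, ?_⟩
  · intro c hc
    have : ((Finset.range k).filter (fun e => key e < key c)).card < (Finset.range k).card := by
      apply Finset.card_lt_card
      rw [Finset.ssubset_iff_of_subset (Finset.filter_subset _ _)]
      exact ⟨c, by simp [hc], by simp⟩
    simpa using this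
  · intro c hc d hd h
    rcases lt_trichotomy (key c) (key d) with h1 | h1 | h1
    · have := hlt c hc d hd h1
      simp only at h
      omega
    · exact hinj c hc d hd h1
    · have := hlt d hd c hc h1
      simp only at h
      omega
  · intro c hc d hd h1 h2
    apply hlt c hc d hd
    simp only [key, h1, h2, if_true, if_false]
    omega

theorem aux_cross {V : Type*} {G : SimpleGraph V} {A B : Set V} (hU : ∀ v, v ∈ A ∨ v ∈ B)
    (hA : G.IsClique A) (hB : G.IsClique B) {k : ℕ} {f : V → ℕ} (hf : IsStarColoring G k f)
    {u v u' v' : V} (huv : G.Adj u v) (hu : u' ≠ u) (hfu : f u' = f u)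
    (hv : v' ≠ v) (hfv : f v' = f v) (huA : u ∈ A) (hvB : v ∈ B) : False := by
  obtain ⟨_, h2, h3⟩ := hf
  have hne := h2 huv
  have hu' : u' ∈ B := (hU u').resolve_left fun h => h2 (hA h huA hu) hfu
  have hv' : v' ∈ A := (hU v').resolve_right fun h => h2 (hB h hvB hv) hfv
  have e1 : u' ≠ v := by rintro rfl; exact hne hfu.symm
  have e2 : u ≠ v' := by rintro rfl; exact hne hfv
  have e3 : u' ≠ v' := by rintro rfl; exact hne (hfu.symm.trans hfv)
  exact h3 (hB hu' hvB e1) huv.symm (hA huA hv' e2) hu e3 hv.symm ⟨hfu, hfv.symm⟩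

theorem aux_walk {V : Type*} {G : SimpleGraph V} (A D : Set V)
    (hD : ∀ u v, G.Adj u v → u ∈ D → v ∈ D → (u ∈ A ↔ v ∈ A)) {a b : V} (p : G.Walk a b)
    (hp : ∀ x ∈ p.support, x ∈ D) : a ∈ A ↔ b ∈ A := by
  induction p with
  | nil => rfl
  | cons h p ih =>
    rw [← ih fun x hx => hp x (by simp [hx])]
    exact hD _ _ h (hp _ (by simp)) (hp _ (by simp))

/-- For a co-bipartite graph, the star, rs and ordered chromatic numbers coincide. -/
theorem star_eq_rs_eq_ordered_of_cobipartite {V : Type*} [Fintype V]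
    (G : SimpleGraph V)
    (h : ∃ A B : Set V, A ∪ B = Set.univ ∧ A ∩ B = ∅ ∧ G.IsClique A ∧ G.IsClique B) :
    starChromaticNumber G = rsChromaticNumber G ∧
      rsChromaticNumber G = orderedChromaticNumber G := by
  obtain ⟨A, B, hAB, hdis, hA, hB⟩ := h
  have hU : ∀ v, v ∈ A ∨ v ∈ B := fun v => by
    have : v ∈ A ∪ B := by rw [hAB]; trivial
    exact this
  have key : ∀ k f, IsStarColoring G k f → ∀ u v, G.Adj u v → (∃ u', u' ≠ u ∧ f u' = f u) →
      (∃ v', v' ≠ v ∧ f v' = f v) → (u ∈ A ↔ v ∈ A) := by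
    rintro k f hf u v huv ⟨u', hu, hfu⟩ ⟨v', hv, hfv⟩
    constructor
    · intro h
      by_contra h'
      exact aux_cross hU hA hB hf huv hu hfu hv hfv h ((hU v).resolve_left h')
    · intro h
      by_contra h'
      exact aux_cross hU hA hB hf huv.symm hv hfv hu hfu h ((hU u).resolve_left h')
  have same : ∀ a b, a ≠ b → (a ∈ A ↔ b ∈ A) → G.Adj a b := by
    intro a b hne h
    by_cases ha : a ∈ A
    · exact hA ha (h.1 ha) hne
    · exact hB ((hU a).resolve_left ha) ((hU b).resolve_left fun hb => ha (h.2 hb)) hne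
  have rs_star : ∀ k f, IsRSColoring G k f → IsStarColoring G k f := by
    rintro k f ⟨h1, h2, h3⟩
    refine ⟨h1, h2, ?_⟩
    rintro a b c d hab hbc hcd hac had hbd ⟨e1, e2⟩
    rcases lt_or_gt_of_ne (h2 hbc) with h | h
    · exact h3 hbc hcd hbd ⟨e2, e2 ▸ h⟩
    · exact h3 hab hbc hac ⟨e1, h⟩
  have ord_star : ∀ k f, IsOrderedColoring G k f → IsStarColoring G k f := by
    rintro k f ⟨h1, h2, h3⟩
    refine ⟨h1, h2, ?_⟩
    have aux : ∀ x y z, G.Adj x y → G.Adj y z → x ≠ z → f x = f z → f x < f y := by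
      intro x y z hxy hyz hxz e
      obtain ⟨w, hw, hlt⟩ := h3 (.cons hxy (.cons hyz .nil))
        (by simp [hxy.ne, hyz.ne, hxz]) hxz e
      simp at hw
      rcases hw with rfl | rfl | rfl <;> omega
    rintro a b c d hab hbc hcd hac had hbd ⟨e1, e2⟩
    have := aux _ _ _ hab hbc hac e1
    have := aux _ _ _ hbc hcd hbd e2
    omega
  have star_rs : ∀ k f, IsStarColoring G k f → ∃ g, IsRSColoring G k g := by
    intro k f hf
    obtain ⟨σ, s1, s2, s3⟩ := aux_relabel (fun c => ¬ ∃ x y, x ≠ y ∧ f x = c ∧ f y = c) k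
    have hk := hf.1
    refine ⟨fun v => σ (f v), fun v => s1 _ (hk v),
      fun x y hxy e => hf.2.1 hxy (s2 _ (hk x) _ (hk y) e), ?_⟩
    rintro x y z hxy hyz hxz ⟨e, hlt⟩
    have e' := s2 _ (hk x) _ (hk z) e
    by_cases hy : ∃ y', y' ≠ y ∧ f y' = f y
    · have k1 := key k f hf x y hxy ⟨z, hxz.symm, e'.symm⟩ hy
      have k2 := key k f hf y z hyz hy ⟨x, hxz, e'⟩
      exact hf.2.1 (same x z hxz (k1.trans k2)) e'
    · have := s3 (f y) (hk y) (f z) (hk z) (by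
        rintro ⟨p, q, hpq, hp, hq⟩
        by_cases h : p = y
        · exact hy ⟨q, fun h' => hpq (h.trans h'.symm), hq⟩
        · exact hy ⟨p, h, hp⟩) (not_not.2 ⟨x, z, hxz, e', rfl⟩)
      simp only at hlt
      omega
  have star_ord : ∀ k f, IsStarColoring G k f → ∃ g, IsOrderedColoring G k g := by
    intro k f hf
    obtain ⟨σ, s1, s2, s3⟩ := aux_relabel (fun c => ∃ x y, x ≠ y ∧ f x = c ∧ f y = c) k
    have hk := hf.1
    refine ⟨fun v => σ (f v), fun v => s1 _ (hk v),
      fun x y hxy e => hf.2.1 hxy (s2 _ (hk x) _ (hk y) e), ?_⟩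
    intro a b p _ hab e
    have e' := s2 _ (hk a) _ (hk b) e
    by_contra hcon
    push Not at hcon
    have := aux_walk A {u | ∃ u', u' ≠ u ∧ f u' = f u}
      (fun u v huv hu hv => key k f hf u v huv hu hv) p (by
        intro x hx
        by_contra hy
        have h1 := s3 (f a) (hk a) (f x) (hk x) ⟨a, b, hab, rfl, e'.symm⟩ (by
          rintro ⟨p, q, hpq, hp, hq⟩
          by_cases h : p = x
          · exact hy ⟨q, fun h' => hpq (h.trans h'.symm), hq⟩
          · exact hy ⟨p, h, hp⟩)
        have h2 := hcon x hx
        omega)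
    exact hf.2.1 (same a b hab this) e'
  have E1 : {k | ∃ f : V → ℕ, IsStarColoring G k f} = {k | ∃ f : V → ℕ, IsRSColoring G k f} :=
    Set.ext fun k => ⟨fun ⟨f, hf⟩ => star_rs k f hf, fun ⟨f, hf⟩ => ⟨f, rs_star k f hf⟩⟩
  have E2 : {k | ∃ f : V → ℕ, IsStarColoring G k f} =
      {k | ∃ f : V → ℕ, IsOrderedColoring G k f} :=
    Set.ext fun k => ⟨fun ⟨f, hf⟩ => star_ord k f hf, fun ⟨f, hf⟩ => ⟨f, ord_star k f hf⟩⟩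
  unfold starChromaticNumber rsChromaticNumber orderedChromaticNumber
  rw [← E1, ← E2]
  exact ⟨rfl, rfl⟩
end

section
/- A finite simple graph G is 2-rs colourable if and only if every connected component of G is a star (i.e., isomorphic to K_{1,p} for some p ≥ 0). -/
theorem star_iso_aux {W : Type*} [Finite W] (H : SimpleGraph W) (u : W)
    (h1 : ∀ w, w ≠ u → H.Adj u w) (h2 : ∀ x y, H.Adj x y → x = u ∨ y = u) :
    ∃ p : ℕ, Nonempty (H ≃g completeBipartiteGraph Unit (Fin p)) := by
  classical
  obtain ⟨p, ⟨e⟩⟩ := Finite.exists_equiv_fin {x : W // ¬ x = u}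
  refine ⟨p, ⟨⟨(Equiv.sumCompl (fun x => x = u)).symm.trans
    (Equiv.sumCongr (Equiv.ofUnique {x : W // x = u} Unit) e), ?_⟩⟩⟩
  intro a b
  by_cases ha : a = u <;> by_cases hb : b = u
  · subst ha; subst hb; simp
  · subst ha; simp [hb, h1 b hb]
  · subst hb; simp [ha, (h1 a ha).symm]
  · have : ¬ H.Adj a b := fun h => by rcases h2 a b h with h | h <;> contradiction
    simp [ha, hb, this]

/-- A finite graph is 2-rs colourable iff every connected component is a star
(isomorphic to `K_{1,p}` for some `p ≥ 0`). -/
theorem two_rs_colourable_iff_components_stars {V : Type*} [Fintype V]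
    (G : SimpleGraph V) :
    (∃ f : V → ℕ, IsRSColoring G 2 f) ↔
      ∀ c : G.ConnectedComponent, ∃ p : ℕ,
        Nonempty ((G.induce c.supp) ≃g completeBipartiteGraph Unit (Fin p)) := by
  classical
  constructor
  · rintro ⟨f, hk, hp, hr⟩ c
    have key : ∃ u ∈ c.supp, f u = 0 ∨ ∀ w ∈ c.supp, f w ≠ 0 := by
      by_cases h : ∃ u ∈ c.supp, f u = 0
      · obtain ⟨u, hu, h⟩ := h
        exact ⟨u, hu, Or.inl h⟩
      · push Not at h
        obtain ⟨u, hu⟩ := c.nonempty_supp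
        exact ⟨u, hu, Or.inr h⟩
    obtain ⟨u, hu, hu0⟩ := key
    have step : ∀ x ∈ c.supp, ∀ y, G.Adj x y → (x = u ∨ G.Adj u x) → (y = u ∨ G.Adj u y) := by
      rintro x hx y hxy (rfl | h)
      · exact Or.inr hxy
      · by_contra hcon
        push Not at hcon
        have hy : y ∈ c.supp := (c.mem_supp_congr_adj hxy).1 hx
        have a1 := hp h
        have a2 := hp hxy
        have b1 := hk u
        have b2 := hk x
        have b3 := hk y
        have a3 := hr h hxy (Ne.symm hcon.1)
        rcases hu0 with h0 | h0
        · omega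
        · have := h0 u hu
          have := h0 x hx
          omega
    have walk : ∀ a b, G.Walk a b → a ∈ c.supp → (a = u ∨ G.Adj u a) → (b = u ∨ G.Adj u b) := by
      intro a b w
      induction w with
      | nil => exact fun _ h => h
      | cons h _ ih => exact fun ha h' => ih ((c.mem_supp_congr_adj h).1 ha) (step _ ha _ h h')
    have all : ∀ w ∈ c.supp, w = u ∨ G.Adj u w := fun w hw =>
      walk u w (c.reachable_of_mem_supp hu hw).some hu (Or.inl rfl)
    refine star_iso_aux _ ⟨u, hu⟩ ?_ ?_
    · rintro ⟨w, hw⟩ hne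
      rcases all w hw with h | h
      · exact absurd (Subtype.ext h) hne
      · exact h
    · rintro ⟨x, hx⟩ ⟨y, hy⟩ hxy
      have hxy : G.Adj x y := hxy
      simp only [Subtype.mk.injEq]
      by_contra hcon
      push Not at hcon
      have h1 := hp ((all x hx).resolve_left hcon.1)
      have h2 := hp ((all y hy).resolve_left hcon.2)
      have h3 := hp hxy
      have b1 := hk u
      have b2 := hk x
      have b3 := hk y
      omega
  · intro h
    have cen : ∀ c : G.ConnectedComponent, ∃ u : V,
        ∀ x ∈ c.supp, ∀ y ∈ c.supp, G.Adj x y → x = u ∨ y = u := by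
      intro c
      obtain ⟨p, ⟨φ⟩⟩ := h c
      refine ⟨(φ.symm (Sum.inl ())).1, fun x hx y hy hxy => ?_⟩
      have hadj : (completeBipartiteGraph Unit (Fin p)).Adj (φ ⟨x, hx⟩) (φ ⟨y, hy⟩) :=
        φ.map_adj_iff.2 hxy
      rcases hX : φ ⟨x, hx⟩ with ⟨⟩ | i
      · left; rw [← hX]; simp
      · rcases hY : φ ⟨y, hy⟩ with ⟨⟩ | j
        · right; rw [← hY]; simp
        · rw [hX, hY] at hadj; simp at hadj
    choose g hg using cen
    have hc : ∀ x y, G.Adj x y → G.connectedComponentMk x = G.connectedComponentMk y :=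
      fun x y h => SimpleGraph.ConnectedComponent.sound h.reachable
    refine ⟨fun v => if v = g (G.connectedComponentMk v) then 0 else 1, ?_, ?_, ?_⟩
    · intro v; dsimp only; split_ifs <;> omega
    · intro x y hxy
      have e := hc x y hxy
      have := hg (G.connectedComponentMk y) x e y rfl hxy
      have hne := hxy.ne
      dsimp only
      rw [e]
      split_ifs <;> grind
    · intro x y z hxy hyz hne
      have e := hc x y hxy
      have e' := hc y z hyz
      dsimp only
      rw [e, e']
      split_ifs <;> grind
end
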